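/- Let w : ℝ → ℝ be the 2-periodic even square wave determined by w(x) = 1 for |x| < 1/2, w(x) = −1 for 1/2 < |x| ≤ 1, and w(1/2) = w(−1/2) = 0. For m, n ∈ ℕ+, set g = gcd(m, n), m' = m/g, n' = n/g. Then ∫_{−1}^{1} w(m·x)·w(n·x) dx = 2·(−1)^{(m'·n' − 1)/2}/(m'·n') if m' and n' are both odd, and = 0 otherwise. -/

import Mathlib

open MeasureTheory intervalIntegral

/-- right-continuous square wave -/
noncomputable def sqU (x : ℝ) : ℝ := (-1 : ℝ) ^ ⌊x + 1 / 2⌋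

lemma sqU_meas : Measurable sqU := by
  have h : Measurable (fun k : ℤ => (-1 : ℝ) ^ k) := measurable_from_top
  exact h.comp (Int.measurable_floor.comp (measurable_id.add_const _))

lemma sqU_abs (x : ℝ) : |sqU x| = 1 := by
  simp [sqU, abs_zpow]

lemma sqU_add_int (x : ℝ) (k : ℤ) : sqU (x + k) = (-1 : ℝ) ^ k * sqU x := by
  unfold sqU
  rw [show x + (k : ℝ) + 1 / 2 = (x + 1 / 2) + k by ring, Int.floor_add_intCast,
    zpow_add₀ (by norm_num), mul_comm]

lemma sqU_sq (x : ℝ) : sqU x * sqU x = 1 := by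
  rw [← abs_mul_abs_self, sqU_abs, one_mul]

lemma neg_one_zpow_odd_mul (a k : ℤ) (ha : Odd a) : (-1 : ℝ) ^ (a * k) = (-1 : ℝ) ^ k := by
  rw [zpow_mul, ha.neg_one_zpow]

lemma w_eq_sqU (w : ℝ → ℝ) (hper : Function.Periodic w 2)
    (h1 : ∀ x : ℝ, |x| < 1 / 2 → w x = 1)
    (h2 : ∀ x : ℝ, 1 / 2 < |x| → |x| ≤ 1 → w x = -1)
    (x : ℝ) (hx : ∀ k : ℤ, x ≠ k + 1 / 2) : w x = sqU x := by
  set q : ℤ := ⌊(x + 1) / 2⌋ with hq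
  obtain ⟨y, hy⟩ : ∃ y, y = x - q * 2 := ⟨_, rfl⟩
  have e1 : w x = w y := by rw [hy, hper.sub_int_mul_eq]
  have e2 : sqU x = sqU y := by
    rw [show x = y + ((q * 2 : ℤ) : ℝ) by rw [hy]; push_cast; ring, sqU_add_int,
      (even_two.mul_left q).neg_one_zpow, one_mul]
  have b1 := Int.floor_le ((x + 1) / 2)
  have b2 := Int.lt_floor_add_one ((x + 1) / 2)
  rw [← hq] at b1 b2
  have n1 : y ≠ 1 / 2 := fun h => hx (q * 2) (by push_cast; linarith)
  have n2 : y ≠ -(1 / 2) := fun h => hx (q * 2 - 1) (by push_cast; linarith)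
  rw [e1, e2]
  rcases lt_or_gt_of_ne n2 with h | h
  · rw [h2 y (by rw [lt_abs]; right; linarith) (by rw [abs_le]; constructor <;> linarith)]
    have : ⌊y + 1 / 2⌋ = -1 := by
      rw [Int.floor_eq_iff]; push_cast; constructor <;> linarith
    rw [sqU, this]; norm_num
  rcases lt_or_gt_of_ne n1 with h' | h'
  · rw [h1 y (by rw [abs_lt]; constructor <;> linarith)]
    have : ⌊y + 1 / 2⌋ = 0 := by
      rw [Int.floor_eq_iff]; push_cast; constructor <;> linarith
    rw [sqU, this, zpow_zero]
  · rw [h2 y (by rw [lt_abs]; left; linarith) (by rw [abs_le]; constructor <;> linarith)]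
    have : ⌊y + 1 / 2⌋ = 1 := by
      rw [Int.floor_eq_iff]; push_cast; constructor <;> linarith
    rw [sqU, this, zpow_one]

lemma w_ae (w : ℝ → ℝ) (hper : Function.Periodic w 2)
    (h1 : ∀ x : ℝ, |x| < 1 / 2 → w x = 1)
    (h2 : ∀ x : ℝ, 1 / 2 < |x| → |x| ≤ 1 → w x = -1)
    (m : ℕ) (hm : 0 < m) : ∀ᵐ x : ℝ, w (m * x) = sqU (m * x) := by
  have hc : (Set.range (fun k : ℤ => ((k : ℝ) + 1 / 2) / m)).Countable := Set.countable_range _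
  filter_upwards [hc.ae_notMem volume] with x hx
  apply w_eq_sqU w hper h1 h2
  intro k hk
  apply hx
  refine ⟨k, ?_⟩
  have : (m : ℝ) ≠ 0 := by positivity
  simp only
  rw [← hk]; field_simp

/-- integer form of the distribution relation -/
lemma dist_int (c : ℕ) (M : ℤ) :
    ∑ k ∈ Finset.range (2 * c + 1), (-1 : ℝ) ^ (k : ℤ) * (-1 : ℝ) ^ ((M + k) / (2 * c + 1 : ℤ))
      = (-1 : ℝ) ^ M := by
  have step : ∀ M : ℤ,
      ∑ k ∈ Finset.range (2 * c + 1), (-1 : ℝ) ^ (k : ℤ) *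
          (-1 : ℝ) ^ ((M + 1 + k) / (2 * c + 1 : ℤ))
      = - ∑ k ∈ Finset.range (2 * c + 1), (-1 : ℝ) ^ (k : ℤ) *
          (-1 : ℝ) ^ ((M + k) / (2 * c + 1 : ℤ)) := by
    intro M
    set f : ℕ → ℝ := fun k => (-1 : ℝ) ^ (k : ℤ) * (-1 : ℝ) ^ ((M + k) / (2 * c + 1 : ℤ)) with hf
    have hk : ∀ k : ℕ, (-1 : ℝ) ^ (k : ℤ) * (-1 : ℝ) ^ ((M + 1 + k) / (2 * c + 1 : ℤ))
        = - f (k + 1) := by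
      intro k
      simp only [hf]
      push_cast
      rw [zpow_add₀ (by norm_num), show M + 1 + (k : ℤ) = M + (k + 1) by ring]
      simp
    simp_rw [hk]
    rw [Finset.sum_neg_distrib, neg_inj]
    have a1 := Finset.sum_range_succ f (2 * c + 1)
    have a2 := Finset.sum_range_succ' f (2 * c + 1)
    have a3 : f (2 * c + 1) = f 0 := by
      simp only [hf]
      push_cast
      rw [Int.add_ediv_of_dvd_right (dvd_refl _), Int.ediv_self (by omega),
        Odd.neg_one_zpow ⟨(c : ℤ), rfl⟩, zpow_add₀ (by norm_num)]
      simp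
    linarith
  induction M using Int.induction_on with
  | zero =>
    have : ∀ k ∈ Finset.range (2 * c + 1), (-1 : ℝ) ^ (k : ℤ) *
        (-1 : ℝ) ^ ((0 + k : ℤ) / (2 * c + 1 : ℤ)) = (-1 : ℝ) ^ k := by
      intro k hk
      rw [Finset.mem_range] at hk
      rw [zero_add, Int.ediv_eq_zero_of_lt (by omega) (by omega)]
      simp
    rw [Finset.sum_congr rfl this, neg_one_geom_sum]
    simp
  | succ i ih =>
    rw [step, ih, zpow_add₀ (by norm_num)]; simp
  | pred i ih =>
    have := step (-(i : ℤ) - 1)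
    rw [sub_add_cancel, ih] at this
    rw [eq_comm, neg_eq_iff_eq_neg] at this
    rw [this, zpow_sub₀ (by norm_num), zpow_one, div_neg, div_one]

lemma dist_sqU (c : ℕ) (y : ℝ) :
    ∑ k ∈ Finset.range (2 * c + 1), (-1 : ℝ) ^ (k : ℤ) * sqU (y + k / (2 * c + 1 : ℕ))
      = (-1 : ℝ) ^ c * sqU ((2 * c + 1 : ℕ) * y) := by
  have key : ∀ k : ℕ, sqU (y + k / (2 * c + 1 : ℕ)) =
      (-1 : ℝ) ^ ((⌊((2 * c + 1 : ℕ) : ℝ) * y + 1 / 2⌋ + c + k) / (2 * c + 1 : ℤ)) := by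
    intro k
    unfold sqU
    congr 1
    have : y + (k : ℝ) / (2 * c + 1 : ℕ) + 1 / 2 =
        ((((2 * c + 1 : ℕ) : ℝ) * y + 1 / 2) + ((c + k : ℤ) : ℝ)) / (2 * c + 1 : ℕ) := by
      push_cast
      field_simp
      ring
    rw [this, Int.floor_div_natCast, Int.floor_add_intCast]
    push_cast
    rw [add_assoc]
  simp_rw [key]
  rw [dist_int, zpow_add₀ (by norm_num), mul_comm]
  simp [sqU]

lemma sum_perm (b : ℕ) (hb : 0 < b) (a : ℕ) (hab : Nat.Coprime a b) (h : ℕ → ℝ)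
    (hp : ∀ k, h (k % b) = h k) :
    ∑ k ∈ Finset.range b, h (a * k) = ∑ k ∈ Finset.range b, h k := by
  have hmaps : Set.MapsTo (fun k => a * k % b) (Finset.range b) (Finset.range b) := by
    intro k _
    simpa using Nat.mod_lt _ hb
  have hinj : Set.InjOn (fun k => a * k % b) (Finset.range b) := by
    intro i hi j hj hij
    simp only [Finset.coe_range, Set.mem_Iio] at hi hj
    have : i ≡ j [MOD b] := Nat.ModEq.cancel_left_of_coprime (by rwa [Nat.gcd_comm]) hij
    rwa [Nat.ModEq, Nat.mod_eq_of_lt hi, Nat.mod_eq_of_lt hj] at this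
  refine Finset.sum_nbij (fun k => a * k % b) hmaps hinj
    (Finset.surjOn_of_injOn_of_card_le _ hmaps hinj le_rfl) ?_
  intro k _
  exact (hp _).symm

lemma int_shift (F : ℝ → ℝ) (hF : Function.Periodic F 2) (d : ℝ) :
    ∫ x in (-1 : ℝ)..1, F (x + d) = ∫ x in (-1 : ℝ)..1, F x := by
  rw [intervalIntegral.integral_comp_add_right]
  have := hF.intervalIntegral_add_eq (-1 + d) (-1)
  rw [show -1 + d + 2 = 1 + d by ring, show (-1 : ℝ) + 2 = 1 by norm_num] at this
  exact this

lemma intble (f : ℝ → ℝ) (hf : Measurable f) (C : ℝ) (hC : ∀ x, |f x| ≤ C) (s t : ℝ) :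
    IntervalIntegrable f volume s t := by
  rw [intervalIntegrable_iff]
  refine Measure.integrableOn_of_bounded (M := C) (by simp) hf.aestronglyMeasurable ?_
  exact Filter.Eventually.of_forall hC

lemma intble_prod (a b : ℕ) (s t : ℝ) :
    IntervalIntegrable (fun x => sqU (a * x) * sqU (b * x)) volume s t := by
  refine intble _ ?_ 1 ?_ _ _
  · exact (sqU_meas.comp (by fun_prop)).mul (sqU_meas.comp (by fun_prop))
  · intro x
    rw [abs_mul, sqU_abs, sqU_abs, one_mul]

lemma int_scale (F : ℝ → ℝ) (hF : Function.Periodic F 2)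
    (hi : ∀ s t : ℝ, IntervalIntegrable F volume s t) (g : ℕ) (hg : 0 < g) :
    ∫ x in (-1 : ℝ)..1, F (g * x) = ∫ x in (-1 : ℝ)..1, F x := by
  have hg' : (g : ℝ) ≠ 0 := by positivity
  rw [intervalIntegral.integral_comp_mul_left _ hg']
  have h := hF.intervalIntegral_add_zsmul_eq (g : ℤ) (-g : ℝ)
  have h' := hF.intervalIntegral_add_eq (-g : ℝ) (-1)
  rw [h', show (-1 : ℝ) + 2 = 1 by norm_num,
    show (-g : ℝ) + (g : ℤ) • (2 : ℝ) = g by simp; ring] at h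
  replace h := h hi
  rw [mul_neg_one, mul_one, h]
  simp [hg']

lemma per_sqU (a : ℕ) (x : ℝ) : sqU (a * (x + 2)) = sqU (a * x) := by
  rw [show (a : ℝ) * (x + 2) = a * x + ((a * 2 : ℤ) : ℝ) by push_cast; ring, sqU_add_int,
    (even_two.mul_left (a : ℤ)).neg_one_zpow, one_mul]

lemma per_prod (a b : ℕ) : Function.Periodic (fun x => sqU (a * x) * sqU (b * x)) 2 := by
  intro x
  simp only [per_sqU]

lemma key_step (a c : ℕ) (ha : Odd a) (hab : Nat.Coprime a (2 * c + 1)) :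
    ∫ x in (-1 : ℝ)..1, sqU (a * x) * sqU ((2 * c + 1 : ℕ) * x) =
      (-1 : ℝ) ^ c / (2 * c + 1 : ℕ) *
        ∫ x in (-1 : ℝ)..1, sqU (a * x) * sqU ((1 : ℕ) * x) := by
  set b : ℕ := 2 * c + 1 with hb
  have hb0 : (b : ℝ) ≠ 0 := by positivity
  have hbodd : Odd (b : ℤ) := ⟨c, by rw [hb]; push_cast; ring⟩
  have haZ : Odd (a : ℤ) := by exact_mod_cast ha
  have pt : ∀ x : ℝ, ∑ k ∈ Finset.range b,
      sqU (a * (x + (k : ℝ) / b)) * sqU (b * (x + (k : ℝ) / b))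
      = (-1 : ℝ) ^ c * (sqU (a * (b * x)) * sqU ((1 : ℕ) * (b * x))) := by
    intro x
    have hh := sum_perm b (by omega) a hab
      (fun k => (-1 : ℝ) ^ (k : ℤ) * sqU (a * x + k / b)) (by
        intro k
        have e : (k : ℝ) = (k % b : ℕ) + (b : ℝ) * (k / b : ℕ) := by
          exact_mod_cast (Nat.mod_add_div k b).symm
        have e' : (k : ℤ) = (k % b : ℕ) + (b : ℤ) * (k / b : ℕ) := by
          exact_mod_cast (Nat.mod_add_div k b).symm
        have e2 : (a : ℝ) * x + k / b =
            (a * x + (k % b : ℕ) / b) + (((k / b : ℕ) : ℤ) : ℝ) := by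
          rw [Int.cast_natCast]
          nth_rewrite 1 [e]
          field_simp
          ring
        rw [e2, sqU_add_int]
        nth_rewrite 1 [e']
        rw [zpow_add₀ (by norm_num), neg_one_zpow_odd_mul _ _ hbodd]
        have := Even.neg_one_zpow (α := ℝ) (Even.add_self (((k / b : ℕ) : ℤ)))
        rw [zpow_add₀ (by norm_num)] at this
        linear_combination (-((-1 : ℝ) ^ ((k % b : ℕ) : ℤ)) * sqU (a * x + (k % b : ℕ) / b)) * this)
    have hd := dist_sqU c (a * x)
    rw [← hb, ← hh] at hd
    have e3 : ∀ k : ℕ, sqU (a * (x + (k : ℝ) / b)) * sqU (b * (x + (k : ℝ) / b)) =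
        ((-1 : ℝ) ^ ((a * k : ℕ) : ℤ) * sqU (a * x + (a * k : ℕ) / b)) * sqU (b * x) := by
      intro k
      rw [show (b : ℝ) * (x + (k : ℝ) / b) = b * x + ((k : ℤ) : ℝ) by
        push_cast; field_simp, sqU_add_int, Nat.cast_mul, neg_one_zpow_odd_mul _ _ haZ,
        show (a : ℝ) * (x + (k : ℝ) / b) = a * x + (a * k : ℕ) / b by push_cast; ring]
      ring
    simp_rw [e3]
    rw [← Finset.sum_mul, hd, Nat.cast_one, one_mul, mul_left_comm (b : ℝ)]
    ring
  have hP := per_prod a b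
  have s1 : ∑ k ∈ Finset.range b, ∫ x in (-1 : ℝ)..1,
      sqU (a * (x + (k : ℝ) / b)) * sqU (b * (x + (k : ℝ) / b)) =
      b * ∫ x in (-1 : ℝ)..1, sqU (a * x) * sqU (b * x) := by
    rw [Finset.sum_congr rfl (fun (k : ℕ) _ => int_shift _ hP ((k : ℝ) / b))]
    simp
  rw [← intervalIntegral.integral_finsetSum] at s1
  · simp_rw [pt] at s1
    rw [intervalIntegral.integral_const_mul, int_scale _ (per_prod a 1) (intble_prod a 1) b (by omega)] at s1
    rw [div_mul_eq_mul_div, s1, mul_div_cancel_left₀ _ hb0]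
  · intro k _
    refine intble _ ?_ 1 ?_ _ _
    · exact (sqU_meas.comp (by fun_prop)).mul (sqU_meas.comp (by fun_prop))
    · intro x
      rw [abs_mul, sqU_abs, sqU_abs, one_mul]

lemma coprime_odd (c d : ℕ) (h : Nat.Coprime (2 * c + 1) (2 * d + 1)) :
    ∫ x in (-1 : ℝ)..1, sqU ((2 * c + 1 : ℕ) * x) * sqU ((2 * d + 1 : ℕ) * x) =
      2 * (-1 : ℝ) ^ (c + d) / ((2 * c + 1 : ℕ) * (2 * d + 1 : ℕ)) := by
  rw [key_step (2 * c + 1) d ⟨c, rfl⟩ h]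
  have := key_step 1 c odd_one (Nat.coprime_one_left _)
  simp_rw [mul_comm (sqU (((2 * c + 1 : ℕ) : ℝ) * _))]
  rw [this]
  simp_rw [sqU_sq]
  rw [intervalIntegral.integral_const, pow_add]
  simp only [smul_eq_mul]
  have h1 : ((2 * c + 1 : ℕ) : ℝ) ≠ 0 := by positivity
  have h2 : ((2 * d + 1 : ℕ) : ℝ) ≠ 0 := by positivity
  field_simp
  ring

lemma int_even_odd (a b : ℕ) (h : Odd (a + b)) :
    ∫ x in (-1 : ℝ)..1, sqU (a * x) * sqU (b * x) = 0 := by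
  have := int_shift _ (per_prod a b) 1
  have e : ∀ x : ℝ, sqU (a * (x + 1)) * sqU (b * (x + 1)) = - (sqU (a * x) * sqU (b * x)) := by
    intro x
    have hz : (-1 : ℝ) ^ (a : ℤ) * (-1 : ℝ) ^ (b : ℤ) = -1 := by
      rw [← zpow_add₀ (by norm_num)]
      exact Odd.neg_one_zpow (by exact_mod_cast h)
    have ea := sqU_add_int (a * x) a
    have eb := sqU_add_int (b * x) b
    rw [Int.cast_natCast] at ea eb
    rw [mul_add, mul_add, mul_one, mul_one, ea, eb]
    linear_combination (sqU (a * x) * sqU (b * x)) * hz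
  simp_rw [e] at this
  rw [intervalIntegral.integral_neg] at this
  linarith

/-- Inner products of the dilations of the `2`-periodic even square wave `w`
(`w = 1` on `|x| < 1/2`, `w = -1` on `1/2 < |x| ≤ 1`, `w(±1/2) = 0`): with
`g = gcd(m,n)`, `m' = m/g`, `n' = n/g`,
`∫_{-1}^{1} w(mx) w(nx) dx = 2 (-1)^{(m'n'-1)/2}/(m'n')` if `m', n'` are both odd,
and `0` otherwise. -/
theorem statement10 (w : ℝ → ℝ) (hper : Function.Periodic w 2)
    (h1 : ∀ x : ℝ, |x| < 1 / 2 → w x = 1)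
    (h2 : ∀ x : ℝ, 1 / 2 < |x| → |x| ≤ 1 → w x = -1)
    (h3 : w (1 / 2) = 0) (h4 : w (-(1 / 2)) = 0)
    (m n : ℕ+) :
    ∫ x in (-1 : ℝ)..1, w (((m : ℕ) : ℝ) * x) * w (((n : ℕ) : ℝ) * x) =
      if Odd ((m : ℕ) / Nat.gcd (m : ℕ) (n : ℕ)) ∧ Odd ((n : ℕ) / Nat.gcd (m : ℕ) (n : ℕ)) then
        2 * (-1 : ℝ) ^
            ((((m : ℕ) / Nat.gcd (m : ℕ) (n : ℕ)) * ((n : ℕ) / Nat.gcd (m : ℕ) (n : ℕ)) - 1) / 2) /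
          ((((m : ℕ) / Nat.gcd (m : ℕ) (n : ℕ) : ℕ) : ℝ) *
            (((n : ℕ) / Nat.gcd (m : ℕ) (n : ℕ) : ℕ) : ℝ))
      else 0 := by
  have hm := m.pos
  have hn := n.pos
  generalize (m : ℕ) = m at *
  generalize (n : ℕ) = n at *
  have hw : ∫ x in (-1 : ℝ)..1, w ((m : ℝ) * x) * w ((n : ℝ) * x) =
      ∫ x in (-1 : ℝ)..1, sqU ((m : ℝ) * x) * sqU ((n : ℝ) * x) := by
    apply intervalIntegral.integral_congr_ae
    filter_upwards [w_ae w hper h1 h2 m hm, w_ae w hper h1 h2 n hn] with x e1 e2 _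
    rw [e1, e2]
  rw [hw]
  have hg : 0 < Nat.gcd m n := Nat.gcd_pos_of_pos_left _ hm
  have hco := Nat.coprime_div_gcd_div_gcd hg
  have em : m / Nat.gcd m n * Nat.gcd m n = m := Nat.div_mul_cancel (Nat.gcd_dvd_left m n)
  have en : n / Nat.gcd m n * Nat.gcd m n = n := Nat.div_mul_cancel (Nat.gcd_dvd_right m n)
  generalize Nat.gcd m n = g at *
  generalize m / g = a at *
  generalize n / g = b at *
  have hs : ∫ x in (-1 : ℝ)..1, sqU ((m : ℝ) * x) * sqU ((n : ℝ) * x) =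
      ∫ x in (-1 : ℝ)..1, sqU ((a : ℝ) * x) * sqU ((b : ℝ) * x) := by
    rw [← int_scale _ (per_prod a b) (intble_prod a b) g hg, ← em, ← en]
    simp only [Nat.cast_mul, mul_assoc]
  rw [hs]
  split_ifs with h
  · obtain ⟨⟨c, rfl⟩, ⟨d, rfl⟩⟩ := h
    rw [coprime_odd c d hco]
    have : ((2 * c + 1) * (2 * d + 1) - 1) / 2 = 2 * (c * d) + (c + d) := by
      have : (2 * c + 1) * (2 * d + 1) = 2 * (2 * (c * d) + (c + d)) + 1 := by ring
      omega
    rw [this, pow_add _ (2 * (c * d)), pow_mul]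
    simp
  · apply int_even_odd
    by_contra hne
    rw [Nat.not_odd_iff_even, Nat.even_add] at hne
    rw [← Nat.not_even_iff_odd, ← Nat.not_even_iff_odd] at h
    have ha : Even a := by tauto
    have hb : Even b := by tauto
    have := Nat.dvd_gcd ha.two_dvd hb.two_dvd
    rw [hco] at this
    omega
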